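/- arXiv:2604.16867 — 11 statements merged into one kernel-verified Lean document; each statement's English description precedes it below -/
import Mathlib

section
/- Let p be a prime, let r, s be integers with 0 ≤ s ≤ r ≤ p − 1, and let a, b ≥ 0 be integers. Then C(pa + r, pb + s) ≡ C(a, b)·C(r, s)·(1 + p·a·(H_r − H_{r−s}) + p·b·(H_{r−s} − H_s)) mod p², as rational numbers. -/
/-- Congruence of rational numbers modulo `p^k`: `x ≡ y mod p^k` means
`x − y` is zero or has `p`-adic valuation at least `k`. -/
def RatCong (p k : ℕ) (x y : ℚ) : Prop :=
  x = y ∨ (k : ℤ) ≤ padicValRat p (x - y)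

/-- The middle binomial coefficients of Vandermonde are divisible by `p`. -/
lemma aux_dvd (p : ℕ) (hp : p.Prime) (a k : ℕ) (hk : ¬ p ∣ k) : p ∣ (p * a).choose k := by
  rcases k with _ | k
  · simp at hk
  rcases Nat.eq_zero_or_pos (p * a) with h | h
  · rw [h]; simp
  obtain ⟨n, hn⟩ := Nat.exists_eq_succ_of_ne_zero h.ne'
  have h1 := Nat.add_one_mul_choose_eq n k
  rw [Nat.succ_eq_add_one] at hn
  rw [← hn] at h1
  have h2 : p ∣ (p * a).choose (k + 1) * (k + 1) := by
    rw [← h1, mul_assoc]; exact dvd_mul_right _ _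
  exact (hp.dvd_mul.mp h2).resolve_right hk

lemma aux_base (p : ℕ) (hp : p.Prime) (a : ℕ) : ∀ b : ℕ,
    ((p * a).choose (p * b) : ℤ) ≡ (a.choose b : ℤ) [ZMOD (p : ℤ) ^ 2] := by
  induction a with
  | zero =>
    intro b
    rcases b with _ | b
    · simp
    · have : 0 < p * (b + 1) := Nat.mul_pos hp.pos (Nat.succ_pos b)
      rw [mul_zero, Nat.choose_eq_zero_of_lt this, Nat.choose_eq_zero_of_lt (Nat.succ_pos b)]
  | succ a ih =>
    intro b
    rcases b with _ | b
    · simp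
    have hv : (p * (a + 1)).choose (p * (b + 1)) =
        ∑ i ∈ Finset.range (p * (b + 1) + 1), p.choose i * (p * a).choose (p * (b + 1) - i) := by
      rw [show p * (a + 1) = p + p * a by ring, Nat.add_choose_eq,
        Finset.Nat.sum_antidiagonal_eq_sum_range_succ_mk]
    have hsplit : Finset.range (p * (b + 1) + 1) =
        insert 0 (insert p ((Finset.range (p * (b + 1) + 1)).filter (fun i => i ≠ 0 ∧ i ≠ p))) := by
      ext i
      have : p ≤ p * (b + 1) := Nat.le_mul_of_pos_right p (Nat.succ_pos b)
      simp only [Finset.mem_range, Finset.mem_insert, Finset.mem_filter]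
      omega
    rw [hsplit, Finset.sum_insert, Finset.sum_insert] at hv
    rotate_left
    · simp
    · have := hp.pos
      simp; omega
    have hmid : p ^ 2 ∣ ∑ i ∈ (Finset.range (p * (b + 1) + 1)).filter (fun i => i ≠ 0 ∧ i ≠ p),
        p.choose i * (p * a).choose (p * (b + 1) - i) := by
      apply Finset.dvd_sum
      intro i hi
      simp only [Finset.mem_range, Finset.mem_filter] at hi
      obtain ⟨h1, h2, h3⟩ := hi
      by_cases hip : p < i
      · rw [Nat.choose_eq_zero_of_lt hip]; simp
      · rw [sq]
        apply mul_dvd_mul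
        · exact hp.dvd_choose_self h2 (by omega)
        · apply aux_dvd p hp
          intro hd
          have : p ∣ i := (Nat.dvd_sub_iff_right (by omega) (dvd_mul_right p _)).mp hd
          have := Nat.le_of_dvd (by omega) this
          omega
    have hpb : p * (b + 1) - p = p * b := by
      rw [mul_add, mul_one, Nat.add_sub_cancel]
    rw [hpb, Nat.choose_zero_right, Nat.choose_self, Nat.sub_zero] at hv
    rw [hv, Nat.choose_succ_succ]
    obtain ⟨c, hc⟩ := hmid
    rw [hc]
    push_cast
    have h1 := ((ih (b + 1)).add (ih b)).symm
    refine Int.ModEq.symm ?_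
    rw [add_comm (a.choose b : ℤ)]
    refine h1.trans ?_
    rw [Int.modEq_iff_dvd]
    exact ⟨c, by push_cast; ring⟩

/-- The ring of `p`-integral rationals. -/
def pInt (p : ℕ) [Fact p.Prime] : Subring ℚ where
  carrier := {x | padicNorm p x ≤ 1}
  mul_mem' := by
    intro x y hx hy
    simp only [Set.mem_setOf_eq] at *
    rw [padicNorm.mul]
    exact mul_le_one₀ hx (padicNorm.nonneg _) hy
  one_mem' := by simp
  add_mem' := by
    intro x y hx hy
    exact padicNorm.nonarchimedean.trans (max_le hx hy)
  zero_mem' := by simp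
  neg_mem' := by
    intro x hx
    simpa using hx

lemma pInt_inv (p : ℕ) [Fact p.Prime] (n : ℕ) (hn : ¬ p ∣ n) : ((n : ℚ))⁻¹ ∈ pInt p := by
  change padicNorm p _ ≤ 1
  have h := (padicNorm.nat_eq_one_iff (p := p) n).mpr hn
  rw [← one_div, padicNorm.div, h]
  simp

lemma pInt_harmonic (p : ℕ) [Fact p.Prime] (r : ℕ) (hr : r < p) : harmonic r ∈ pInt p := by
  unfold harmonic
  apply Subring.sum_mem
  intro i hi
  apply pInt_inv
  intro hd
  have := Nat.le_of_dvd (Nat.succ_pos i) hd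
  have := Finset.mem_range.mp hi
  omega

/-- `(pn+1)⋯(pn+r)`. -/
def rise (p n r : ℕ) : ℕ := ∏ i ∈ Finset.range r, (p * n + i + 1)

lemma rise_fact (p n r : ℕ) : (p * n).factorial * rise p n r = (p * n + r).factorial := by
  induction r with
  | zero => simp [rise]
  | succ r ih =>
    have : rise p n (r + 1) = rise p n r * (p * n + r + 1) := Finset.prod_range_succ _ _
    rw [this, ← mul_assoc, ih, ← add_assoc, Nat.factorial_succ]; ring

lemma rise_unit (p n r : ℕ) (hp : p.Prime) (hr : r < p) : ¬ p ∣ rise p n r := by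
  intro h
  obtain ⟨i, hi, hd⟩ := (hp.prime.dvd_finset_prod_iff _).mp h
  rw [add_assoc, Nat.dvd_add_right (dvd_mul_right p n)] at hd
  have := Nat.le_of_dvd (Nat.succ_pos i) hd
  have := Finset.mem_range.mp hi
  omega

lemma rise_cong (p : ℕ) [Fact p.Prime] (n r : ℕ) (hr : r < p) :
    ∃ z ∈ pInt p, (rise p n r : ℚ) = r.factorial * (1 + p * n * harmonic r) + p ^ 2 * z := by
  induction r with
  | zero => exact ⟨0, zero_mem _, by simp [rise]⟩
  | succ r ih =>
    obtain ⟨z, hz, h⟩ := ih (by omega)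
    have hH := pInt_harmonic p r (by omega)
    have : rise p n (r + 1) = rise p n r * (p * n + r + 1) := Finset.prod_range_succ _ _
    refine ⟨r.factorial * n ^ 2 * harmonic r + z * (p * n + r + 1), ?_, ?_⟩
    · exact add_mem (mul_mem (mul_mem (natCast_mem _ _) (pow_mem (natCast_mem _ _) _)) hH)
        (mul_mem hz (add_mem (add_mem (mul_mem (natCast_mem _ _) (natCast_mem _ _))
          (natCast_mem _ _)) (one_mem _)))
    · rw [this, harmonic_succ, Nat.factorial_succ]
      push_cast
      rw [h]
      have : (r : ℚ) + 1 ≠ 0 := by positivity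
      field_simp
      ring

lemma aux_choose (m n : ℕ) :
    (m + n).choose m * m.factorial * n.factorial = (m + n).factorial := by
  have h := Nat.choose_mul_factorial_mul_factorial (Nat.le_add_right m n)
  rwa [Nat.add_sub_cancel_left] at h

lemma aux_main (S : Subring ℚ) (p X Y Rs Rt Rr Fs Ft F C C2 Ca d zr zs zt A B G : ℚ)
    (hP : p ∈ S) (hY : Y ∈ S) (hRt : Rt ∈ S) (hRr : Rr ∈ S) (hFs : Fs ∈ S) (hF : F ∈ S)
    (hC : C ∈ S) (hd : d ∈ S) (hzr : zr ∈ S) (hzs : zs ∈ S) (hzt : zt ∈ S)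
    (hA : A ∈ S) (hB : B ∈ S) (hG : G ∈ S) (hs : Rs⁻¹ ∈ S) (ht : Rt⁻¹ ∈ S)
    (ns : Rs ≠ 0) (nt : Rt ≠ 0)
    (er : Rr = F * (1 + p * A) + p ^ 2 * zr) (es : Rs = Fs * (1 + p * B) + p ^ 2 * zs)
    (et : Rt = Ft * (1 + p * G) + p ^ 2 * zt) (hdq : Ca = C + p ^ 2 * d)
    (hst : Fs * Ft * C2 = F) (key : X * Rs * Rt = Ca * Rr)
    (eY : Y = C * C2 * (1 + p * (A - B - G))) :
    ∃ z ∈ S, X - Y = p ^ 2 * z := by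
  have hD : A - B - G ∈ S := sub_mem (sub_mem hA hB) hG
  obtain ⟨D, eD⟩ : ∃ D, D = A - B - G := ⟨_, rfl⟩
  rw [← eD] at hD eY
  obtain ⟨Q, eQ⟩ : ∃ Q, Q = D * B + D * G + B * G + p * (D * B * G) := ⟨_, rfl⟩
  have hQ : Q ∈ S := by
    rw [eQ]
    exact add_mem (add_mem (add_mem (mul_mem hD hB) (mul_mem hD hG)) (mul_mem hB hG))
      (mul_mem hP (mul_mem (mul_mem hD hB) hG))
  refine ⟨(d * Rr + C * zr - C * F * Q - Y * (zs * Rt) - Y * (Fs * (1 + p * B) * zt))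
    * (Rs⁻¹ * Rt⁻¹), ?_, ?_⟩
  · exact mul_mem (sub_mem (sub_mem (sub_mem (add_mem (mul_mem hd hRr) (mul_mem hC hzr))
      (mul_mem (mul_mem hC hF) hQ)) (mul_mem hY (mul_mem hzs hRt)))
      (mul_mem hY (mul_mem (mul_mem hFs (add_mem (one_mem S) (mul_mem hP hB))) hzt)))
      (mul_mem hs ht)
  · have e : (X - Y) * (Rs * Rt) = p ^ 2 *
        (d * Rr + C * zr - C * F * Q - Y * (zs * Rt) - Y * (Fs * (1 + p * B) * zt)) := by
      have e1 : Rs * Rt = Fs * Ft * ((1 + p * B) * (1 + p * G))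
          + p ^ 2 * (zs * Rt + Fs * (1 + p * B) * zt) := by
        rw [es, et]; ring
      have e2 : Y * (Fs * Ft * ((1 + p * B) * (1 + p * G)))
          = C * F * (1 + p * A) + p ^ 2 * (C * F * Q) := by
        rw [eY, ← hst, eQ, eD]
        ring
      have e3 : X * (Rs * Rt) = C * (F * (1 + p * A)) + p ^ 2 * (d * Rr + C * zr) := by
        rw [← mul_assoc, key, hdq]
        linear_combination C * er
      rw [sub_mul, e3]
      linear_combination (-Y) * e1 - e2
    rw [← mul_assoc, ← e]
    field_simp

theorem lucas_mod_p_sq (p : ℕ) (hp : p.Prime) (r s a b : ℕ)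
    (hsr : s ≤ r) (hr : r ≤ p - 1) :
    RatCong p 2 (((p * a + r).choose (p * b + s) : ℚ))
      ((a.choose b : ℚ) * (r.choose s : ℚ) *
        (1 + (p : ℚ) * a * (harmonic r - harmonic (r - s)) +
          (p : ℚ) * b * (harmonic (r - s) - harmonic s))) := by
  haveI : Fact p.Prime := ⟨hp⟩
  have hpos := hp.pos
  rcases lt_or_ge a b with hab | hab
  · left
    have h1 : p * (a + 1) ≤ p * b := Nat.mul_le_mul_left p hab
    rw [Nat.choose_eq_zero_of_lt hab, Nat.choose_eq_zero_of_lt (by rw [mul_add] at h1; omega)]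
    simp
  obtain ⟨c, rfl⟩ := Nat.exists_eq_add_of_le hab
  obtain ⟨t, rfl⟩ := Nat.exists_eq_add_of_le hsr
  rw [Nat.add_sub_cancel_left]
  obtain ⟨zr, hzr, er⟩ := rise_cong p (b + c) (s + t) (by omega)
  obtain ⟨zs, hzs, es⟩ := rise_cong p b s (by omega)
  obtain ⟨zt, hzt, et⟩ := rise_cong p c t (by omega)
  have us := rise_unit p b s hp (by omega)
  have ut := rise_unit p c t hp (by omega)
  have is := pInt_inv p _ us
  have it := pInt_inv p _ ut
  have ns : (rise p b s : ℚ) ≠ 0 := by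
    intro h; apply us; rw [Nat.cast_eq_zero.mp h]; exact dvd_zero p
  have nt : (rise p c t : ℚ) ≠ 0 := by
    intro h; apply ut; rw [Nat.cast_eq_zero.mp h]; exact dvd_zero p
  have hHr := pInt_harmonic p (s + t) (by omega)
  have hHs := pInt_harmonic p s (by omega)
  have hHt := pInt_harmonic p t (by omega)
  have hbase := (aux_base p hp (b + c) b).symm
  rw [Int.modEq_iff_dvd] at hbase
  obtain ⟨d, hd⟩ := hbase
  have hdq : ((p * (b + c)).choose (p * b) : ℚ) = (b + c).choose b + p ^ 2 * d := by
    have : (((p * (b + c)).choose (p * b) : ℤ) : ℚ) - (((b + c).choose b : ℤ) : ℚ)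
        = p ^ 2 * d := by exact_mod_cast congrArg (Int.cast : ℤ → ℚ) hd
    push_cast at this
    linarith
  have hst : (s.factorial : ℚ) * t.factorial * (s + t).choose s = (s + t).factorial := by
    have := aux_choose s t
    rw [← this]; push_cast; ring
  -- exact identity
  have key : ((p * (b + c) + (s + t)).choose (p * b + s) : ℚ) * rise p b s * rise p c t
      = (p * (b + c)).choose (p * b) * rise p (b + c) (s + t) := by
    have h1 := aux_choose (p * b + s) (p * c + t)
    have h2 := aux_choose (p * b) (p * c)
    rw [show p * b + s + (p * c + t) = p * (b + c) + (s + t) by ring, ← rise_fact p b s,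
      ← rise_fact p c t, ← rise_fact p (b + c) (s + t)] at h1
    rw [← mul_add] at h2
    rw [← h2] at h1
    have f1 := Nat.factorial_pos (p * b)
    have f2 := Nat.factorial_pos (p * c)
    have h3 : (p * (b + c) + (s + t)).choose (p * b + s) * rise p b s * rise p c t
      = (p * (b + c)).choose (p * b) * rise p (b + c) (s + t) := by
      apply Nat.eq_of_mul_eq_mul_left (Nat.mul_pos f1 f2)
      linarith
    exact_mod_cast h3
  have hS : ∀ n : ℕ, (n : ℚ) ∈ pInt p := fun n => natCast_mem _ n
  have hdS : (d : ℚ) ∈ pInt p := intCast_mem _ d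
  generalize hX : ((p * (b + c) + (s + t)).choose (p * b + s) : ℚ) = X at *
  generalize hCa : ((p * (b + c)).choose (p * b) : ℚ) = Ca at *
  have hC := hS ((b + c).choose b)
  have hC2 := hS ((s + t).choose s)
  have hF := hS (s + t).factorial
  have hFs := hS s.factorial
  have hFt := hS t.factorial
  have hP := hS p
  have hb := hS b
  have hc := hS c
  have hRs := hS (rise p b s)
  have hRt := hS (rise p c t)
  have hRr := hS (rise p (b + c) (s + t))
  push_cast at er ⊢
  generalize ((b + c).choose b : ℚ) = C at *
  generalize ((s + t).choose s : ℚ) = C2 at *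
  generalize ((s + t).factorial : ℚ) = F at *
  generalize (s.factorial : ℚ) = Fs at *
  generalize (t.factorial : ℚ) = Ft at *
  generalize (rise p b s : ℚ) = Rs at *
  generalize (rise p c t : ℚ) = Rt at *
  generalize (rise p (b + c) (s + t) : ℚ) = Rr at *
  generalize harmonic (s + t) = Hr at *
  generalize harmonic s = Hs at *
  generalize harmonic t = Ht at *
  generalize hY : C * C2 * (1 + (p : ℚ) * (b + c) * (Hr - Ht) + p * b * (Ht - Hs)) = Y
  have hYS : Y ∈ pInt p := by
    rw [← hY]
    exact mul_mem (mul_mem hC hC2) (add_mem (add_mem (one_mem _)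
      (mul_mem (mul_mem hP (add_mem hb hc)) (sub_mem hHr hHt)))
      (mul_mem (mul_mem hP hb) (sub_mem hHt hHs)))
  have main : ∃ z ∈ pInt p, X - Y = p ^ 2 * z :=
    aux_main (pInt p) p X Y Rs Rt Rr Fs Ft F C C2 Ca d zr zs zt ((b + c) * Hr) (b * Hs) (c * Ht)
      hP hYS hRt hRr hFs hF hC hdS hzr hzs hzt (mul_mem (add_mem hb hc) hHr) (mul_mem hb hHs)
      (mul_mem hc hHt) is it ns nt (by rw [er]; ring) (by rw [es]; ring) (by rw [et]; ring)
      hdq hst key (by rw [← hY]; ring)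
  obtain ⟨z, hz, hXY⟩ := main
  by_cases h0 : X = Y
  · left; exact h0
  right
  rw [hXY]
  have hz0 : z ≠ 0 := by
    rintro rfl
    apply h0
    rw [mul_zero] at hXY
    linarith
  have hp0 : (p : ℚ) ≠ 0 := by exact_mod_cast hpos.ne'
  rw [padicValRat.mul (pow_ne_zero _ hp0) hz0, padicValRat.pow, padicValRat.self hp.one_lt]
  have hv : 0 ≤ padicValRat p z := by
    have hz' : padicNorm p z ≤ 1 := hz
    rw [padicNorm.eq_zpow_of_nonzero hz0] at hz'
    have := (zpow_le_one_iff_right₀ (by exact_mod_cast hp.one_lt : (1 : ℚ) < p)).mp hz'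
    omega
  push_cast
  omega
end

section
/- Let p be a prime and let i, x, y ≥ 0 be integers. Then {y + p^i brace x} ≡ {y + 1 brace x} + Σ_{j=1}^{i} {y brace x − p^j} mod p. -/
/-- Stirling number of the second kind `{t brace s}` (with the convention `0^0 = 1`),
viewed as a rational number. -/
def stir (t s : ℕ) : ℚ :=
  (1 / (Nat.factorial s : ℚ)) *
    ∑ j ∈ Finset.range (s + 1), (-1 : ℚ) ^ j * (s.choose j : ℚ) * ((s - j : ℕ) : ℚ) ^ t

/-- Stirling number of the second kind with an integer second argument,
with the convention that `{t brace s} = 0` for `s < 0`. -/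
def stirZ (t : ℕ) (s : ℤ) : ℚ :=
  if s < 0 then 0 else stir t s.toNat

open Polynomial in
/-- The operator `f ↦ X (f + f')`. -/
noncomputable def stOp (p : ℕ) : Module.End (ZMod p) (ZMod p)[X] :=
  LinearMap.mulLeft (ZMod p) X * (Polynomial.derivative + 1)

open Polynomial in
theorem stOp_apply (p : ℕ) (f : (ZMod p)[X]) : stOp p f = X * (derivative f + f) := by
  simp [stOp]

open Polynomial in
theorem stOp_coeff (p : ℕ) (t s : ℕ) :
    ((stOp p ^ t) 1).coeff s = (Nat.stirlingSecond t s : ZMod p) := by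
  induction t generalizing s with
  | zero =>
    cases s with
    | zero => simp
    | succ s => simp [coeff_one]
  | succ t ih =>
    rw [pow_succ', Module.End.mul_apply, stOp_apply]
    cases s with
    | zero => simp
    | succ s =>
      rw [coeff_X_mul, coeff_add, coeff_derivative, ih, ih, Nat.stirlingSecond_succ_succ]
      push_cast; ring

open Polynomial in
theorem descPoch_zmod (p : ℕ) [hp : Fact p.Prime] :
    descPochhammer (ZMod p) p = X ^ p - X := by
  have h1 : (X ^ p - X : (ZMod p)[X]).Monic :=
    monic_X_pow_sub (by rw [degree_X]; exact_mod_cast hp.out.one_lt)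
  have h2 := monic_descPochhammer (ZMod p) p
  have d1 : (X ^ p - X : (ZMod p)[X]).natDegree = p :=
    FiniteField.X_pow_card_sub_X_natDegree_eq _ hp.out.one_lt
  have d2 := descPochhammer_natDegree (R := ZMod p) p
  apply Polynomial.eq_of_degree_sub_lt_of_eval_finset_eq Finset.univ
  · have := degree_sub_lt_left (p := descPochhammer (ZMod p) p) (q := X ^ p - X)
      (by rw [degree_eq_natDegree h1.ne_zero, degree_eq_natDegree h2.ne_zero, d1, d2])
      h2.ne_zero (by rw [h1.leadingCoeff, h2.leadingCoeff])
    rw [degree_eq_natDegree h2.ne_zero, d2] at this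
    simpa [ZMod.card] using this
  · intro x _
    obtain ⟨n, hn, rfl⟩ : ∃ n : ℕ, n < p ∧ (n : ZMod p) = x :=
      ⟨x.val, x.val_lt, ZMod.natCast_zmod_val x⟩
    rw [descPochhammer_eval_eq_descFactorial, Nat.descFactorial_of_lt hn]
    simp

open Polynomial in
theorem stOp_mul_X (p n : ℕ) :
    stOp p * LinearMap.mulLeft (ZMod p) (X ^ n)
      = LinearMap.mulLeft (ZMod p) (X ^ n) * (stOp p + (n : Module.End (ZMod p) (ZMod p)[X])) := by
  refine LinearMap.ext fun f => ?_
  simp only [Module.End.mul_apply, LinearMap.add_apply, LinearMap.mulLeft_apply, stOp_apply,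
    Module.End.natCast_apply, derivative_mul, derivative_X_pow, nsmul_eq_mul]
  cases n with
  | zero => simp
  | succ n => simp; ring

open Polynomial in
theorem stOp_desc (p n : ℕ) :
    aeval (stOp p) (descPochhammer (ZMod p) n)
      = LinearMap.mulLeft (ZMod p) (X ^ n) * ((derivative : Module.End (ZMod p) (ZMod p)[X]) + 1) ^ n := by
  induction n with
  | zero => refine LinearMap.ext fun f => ?_; simp
  | succ n ih =>
    rw [descPochhammer_succ_right, mul_comm, map_mul, ih, ← mul_assoc]
    have : aeval (stOp p) (X - (n : (ZMod p)[X])) * LinearMap.mulLeft (ZMod p) (X ^ n)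
        = LinearMap.mulLeft (ZMod p) (X ^ n) * stOp p := by
      rw [map_sub, aeval_X, map_natCast, sub_mul, stOp_mul_X, mul_add,
        (Nat.cast_commute n _).eq, add_sub_cancel_right]
    rw [this, pow_succ' (_ + _) n, ← mul_assoc]
    congr 1
    refine LinearMap.ext fun f => ?_
    simp [stOp_apply]; ring

open Polynomial in
theorem charP_end (p : ℕ) [hp : Fact p.Prime] : CharP (Module.End (ZMod p) (ZMod p)[X]) p :=
  charP_of_injective_algebraMap (algebraMap (ZMod p) _).injective p

open Polynomial in
theorem stOp_pow_p (p : ℕ) [hp : Fact p.Prime] :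
    stOp p ^ p = stOp p + LinearMap.mulLeft (ZMod p) (X ^ p) := by
  have := charP_end p
  have h := stOp_desc p p
  rw [descPoch_zmod, add_pow_char_of_commute p (Commute.one_right _), one_pow] at h
  have hd : (derivative : Module.End (ZMod p) (ZMod p)[X]) ^ p = 0 := by
    refine LinearMap.ext fun f => ?_
    rw [Module.End.pow_apply, ← factorial_smul_hasseDeriv, LinearMap.smul_apply,
      ← Nat.cast_smul_eq_nsmul (ZMod p),
      (ZMod.natCast_eq_zero_iff _ _).2 (Nat.dvd_factorial hp.out.pos le_rfl)]
    simp
  rw [hd, zero_add, mul_one, map_sub, map_pow, aeval_X] at h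
  rw [← h]; abel

open Polynomial in
theorem stOp_pow_pow (p : ℕ) [hp : Fact p.Prime] (i : ℕ) :
    stOp p ^ p ^ i
      = stOp p + LinearMap.mulLeft (ZMod p) (∑ j ∈ Finset.Icc 1 i, X ^ p ^ j) := by
  have := charP_end p
  induction i with
  | zero => refine LinearMap.ext fun f => ?_; simp
  | succ i ih =>
    rw [pow_succ, pow_mul, ih, add_pow_char_of_commute, stOp_pow_p, add_assoc,
      LinearMap.pow_mulLeft, sum_pow_char]
    · congr 1
      have : ∑ j ∈ Finset.Icc 1 (i + 1), (X : (ZMod p)[X]) ^ p ^ j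
          = X ^ p + ∑ j ∈ Finset.Icc 1 i, (X ^ p ^ j) ^ p := by
        simp only [← Finset.Ico_add_one_right_eq_Icc]
        rw [Finset.sum_eq_sum_Ico_succ_bot (by omega), pow_one,
          ← Finset.sum_Ico_add' _ 1 (i + 1) 1]
        simp only [pow_succ, pow_mul]
      rw [this]
      refine LinearMap.ext fun f => ?_
      simp [add_mul]
    · have : ∀ s : Finset ℕ, (∀ j ∈ s, 1 ≤ j) →
          Commute (stOp p) (LinearMap.mulLeft (ZMod p) (∑ j ∈ s, X ^ p ^ j)) := by
        intro s hs
        have e : LinearMap.mulLeft (ZMod p) (∑ j ∈ s, (X : (ZMod p)[X]) ^ p ^ j)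
            = ∑ j ∈ s, LinearMap.mulLeft (ZMod p) (X ^ p ^ j) := by
          refine LinearMap.ext fun f => ?_
          simp [LinearMap.sum_apply, Finset.sum_mul]
        rw [e]
        refine Commute.sum_right _ _ _ fun j hj => ?_
        have h := stOp_mul_X p (p ^ j)
        have h0 : ((p ^ j : ℕ) : Module.End (ZMod p) (ZMod p)[X]) = 0 :=
          (CharP.cast_eq_zero_iff _ p _).2 (dvd_pow_self p (by have := hs j hj; omega))
        rwa [h0, add_zero] at h
      exact this _ fun j hj => (Finset.mem_Icc.1 hj).1

theorem stirlingSecond_cong (p : ℕ) [hp : Fact p.Prime] (i x y : ℕ) :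
    (Nat.stirlingSecond (y + p ^ i) x : ZMod p) = Nat.stirlingSecond (y + 1) x
      + ∑ j ∈ Finset.Icc 1 i,
        if p ^ j ≤ x then (Nat.stirlingSecond y (x - p ^ j) : ZMod p) else 0 := by
  rw [← stOp_coeff, ← stOp_coeff, add_comm y, pow_add, stOp_pow_pow, add_comm y 1, pow_add,
    pow_one, add_mul, LinearMap.add_apply, Polynomial.coeff_add]
  congr 1
  rw [Module.End.mul_apply, LinearMap.mulLeft_apply, Finset.sum_mul, Polynomial.finsetSum_coeff]
  refine Finset.sum_congr rfl fun j _ => ?_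
  rw [Polynomial.coeff_X_pow_mul', stOp_coeff]

theorem stir_sum_rec (t s : ℕ) :
    ∑ j ∈ Finset.range (s + 2), (-1 : ℚ) ^ j * ((s + 1).choose j : ℚ) * ((s + 1 - j : ℕ) : ℚ) ^ (t + 1)
    = (s + 1) * (∑ j ∈ Finset.range (s + 2), (-1 : ℚ) ^ j * ((s + 1).choose j : ℚ) * ((s + 1 - j : ℕ) : ℚ) ^ t
      + ∑ j ∈ Finset.range (s + 1), (-1 : ℚ) ^ j * (s.choose j : ℚ) * ((s - j : ℕ) : ℚ) ^ t) := by
  have h1 : ∑ j ∈ Finset.range (s + 2), (-1 : ℚ) ^ j * ((s + 1).choose j : ℚ) * ((s + 1 - j : ℕ) : ℚ) ^ t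
      + ∑ j ∈ Finset.range (s + 1), (-1 : ℚ) ^ j * (s.choose j : ℚ) * ((s - j : ℕ) : ℚ) ^ t
      = ∑ j ∈ Finset.range (s + 2), (-1 : ℚ) ^ j * (s.choose j : ℚ) * ((s + 1 - j : ℕ) : ℚ) ^ t := by
    rw [Finset.sum_range_succ' _ (s + 1), Finset.sum_range_succ' _ (s + 1), add_right_comm,
      ← Finset.sum_add_distrib]
    congr 1
    · refine Finset.sum_congr rfl fun j _ => ?_
      rw [Nat.choose_succ_succ, Nat.add_sub_add_right]
      push_cast; ring
    · simp
  rw [h1, Finset.mul_sum]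
  refine Finset.sum_congr rfl fun j _ => ?_
  have := congrArg (Nat.cast (R := ℚ)) (Nat.choose_mul_succ_eq s j)
  rw [Nat.cast_mul, Nat.cast_mul, Nat.cast_add_one] at this
  rw [pow_succ]
  linear_combination (-(-1 : ℚ) ^ j * ((s + 1 - j : ℕ) : ℚ) ^ t) * this

theorem stir_eq (t s : ℕ) : stir t s = Nat.stirlingSecond t s := by
  induction t generalizing s with
  | zero =>
    have h := Int.alternating_sum_range_choose (n := s)
    have h' := congrArg (Int.cast (R := ℚ)) h
    push_cast at h'
    unfold stir
    simp only [pow_zero, mul_one]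
    rw [h']
    cases s <;> simp
  | succ t ih =>
    cases s with
    | zero => simp [stir]
    | succ s =>
      have a := ih (s + 1)
      have b := ih s
      rw [Nat.stirlingSecond_succ_succ]
      push_cast
      rw [← a, ← b]
      unfold stir
      rw [stir_sum_rec, Nat.factorial_succ]
      have : (s.factorial : ℚ) ≠ 0 := by positivity
      have h2 : (s + 1 : ℚ) ≠ 0 := by positivity
      push_cast
      field_simp

theorem lucas_for_stirling (p : ℕ) (hp : p.Prime) (i x y : ℕ) :
    RatCong p 1 (stir (y + p ^ i) x)
      (stir (y + 1) x + ∑ j ∈ Finset.Icc 1 i, stirZ y ((x : ℤ) - (p : ℤ) ^ j)) := by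
  have : Fact p.Prime := ⟨hp⟩
  have hz : ∀ j, stirZ y ((x : ℤ) - (p : ℤ) ^ j)
      = ((if p ^ j ≤ x then Nat.stirlingSecond y (x - p ^ j) else 0 : ℕ) : ℚ) := by
    intro j
    unfold stirZ
    by_cases h : p ^ j ≤ x
    · have h' : (p : ℤ) ^ j ≤ x := by exact_mod_cast h
      have e : ((x : ℤ) - (p : ℤ) ^ j).toNat = x - p ^ j := by
        rw [← Nat.cast_pow]; omega
      rw [if_neg (by omega), if_pos h, e, stir_eq]
    · have h' : (x : ℤ) < (p : ℤ) ^ j := by exact_mod_cast not_le.1 h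
      rw [if_pos (by omega), if_neg h, Nat.cast_zero]
  simp only [hz, stir_eq]
  have key := stirlingSecond_cong p i x y
  set A := Nat.stirlingSecond (y + p ^ i) x
  obtain ⟨B, hB⟩ : ∃ B : ℕ, B = Nat.stirlingSecond (y + 1) x + ∑ j ∈ Finset.Icc 1 i,
    (if p ^ j ≤ x then Nat.stirlingSecond y (x - p ^ j) else 0 : ℕ) := ⟨_, rfl⟩
  have hAB : ((A : ℤ) : ZMod p) = ((B : ℤ) : ZMod p) := by
    rw [hB]; push_cast; exact key
  rw [← Nat.cast_sum, ← Nat.cast_add, ← hB]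
  unfold RatCong
  by_cases h : A = B
  · left; rw [h]
  · right
    have hd : (p : ℤ) ∣ (A : ℤ) - B := by
      rw [← ZMod.intCast_zmod_eq_zero_iff_dvd, Int.cast_sub, hAB, sub_self]
    have e : (A : ℚ) - B = (((A : ℤ) - B : ℤ) : ℚ) := by push_cast; rfl
    rw [e, padicValRat.of_int]
    have := (padicValInt_dvd_iff 1 ((A : ℤ) - B)).1 (by simpa using hd)
    have h3 : (A : ℤ) - B ≠ 0 := by omega
    exact_mod_cast this.resolve_left h3
end

section
/- Let p ≥ 5 be a prime and let n be an integer with p ≤ n ≤ p² − p − 1. Set b = ⌊n/p⌋ and I = {0, 1, …, n} ∪ {(b+1)p}. Then there exist p-adic integers λ_i ∈ ℤ_p for i ∈ I with λ_{(b+1)p} = −1 such that: (i) Σ_{i∈I} λ_i·i^j = 0 in ℤ_p for all 0 ≤ j ≤ n; (ii) for every fixed 0 ≤ a ≤ p − 1 and every 0 ≤ j ≤ n, the sum Σ_{i∈I, i ≡ a mod p} λ_i·i^j is divisible by p² in ℤ_p; (iii) λ_i ≡ (−1)^{b − i/p}·C(b+1, i/p) mod p whenever p divides i; (iv) λ_i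 ≡ 0 mod p whenever p does not divide i. -/
def exLam (N n i : ℕ) : ℤ := (-1) ^ (n - i) * (N.choose i : ℤ) * ((N - 1 - i).choose (n - i) : ℤ)

lemma exLam_newton (N n j : ℕ) (h : n < N) (hj : j ≤ n) :
    ∑ i ∈ Finset.range (n + 1), exLam N n i * (i : ℤ) ^ j = (N : ℤ) ^ j := by
  have h1 := shift_eq_sum_fwdDiff_iter (1 : ℤ) (fun r : ℤ => r ^ j) N 0
  simp only [zero_add, nsmul_eq_mul, mul_one] at h1
  rw [h1]
  have hsub : Finset.range (n + 1) ⊆ Finset.range (N + 1) := by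
    intro x; simp only [Finset.mem_range]; omega
  rw [← Finset.sum_subset hsub]
  swap
  · intro k _ hk
    simp only [Finset.mem_range] at hk
    rw [fwdDiff_iter_pow_eq_zero_of_lt (by omega)]
    simp
  simp only [fwdDiff_iter_eq_sum_shift]
  have h2 : ∀ k ∈ Finset.range (n + 1), (N.choose k : ℤ) * ∑ i ∈ Finset.range (k + 1),
      ((-1 : ℤ) ^ (k - i) * (k.choose i : ℤ)) • ((0 : ℤ) + i • (1 : ℤ)) ^ j =
      ∑ i ∈ Finset.range (n + 1), (N.choose k : ℤ) * (((-1 : ℤ) ^ (k - i) * (k.choose i : ℤ)) * (i : ℤ) ^ j) := by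
    intro k hk
    simp only [Finset.mem_range] at hk
    rw [Finset.mul_sum]
    have : Finset.range (k + 1) ⊆ Finset.range (n + 1) := by
      intro x; simp only [Finset.mem_range]; omega
    rw [← Finset.sum_subset this]
    · simp
    · intro i _ hi
      simp only [Finset.mem_range] at hi
      rw [Nat.choose_eq_zero_of_lt (show k < i by omega)]
      simp
  rw [Finset.sum_congr rfl h2, Finset.sum_comm]
  refine Finset.sum_congr rfl fun i hi => ?_
  simp only [Finset.mem_range] at hi
  obtain ⟨m, rfl⟩ : ∃ m, n = i + m := ⟨n - i, by omega⟩
  obtain ⟨M, rfl⟩ : ∃ M, N = i + (M + 1) := ⟨N - i - 1, by omega⟩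
  have h3 := Int.alternating_sum_range_choose_eq_choose (n := M) (m := m)
  have h4 : ∑ k ∈ Finset.range (i + m + 1), ((i + (M + 1)).choose k : ℤ) * (((-1 : ℤ) ^ (k - i) * (k.choose i : ℤ)) * (i : ℤ) ^ j)
      = ∑ k ∈ Finset.range (m + 1), ((i + (M + 1)).choose i : ℤ) * (i : ℤ) ^ j * ((-1) ^ k * ((M + 1).choose k : ℤ)) := by
    rw [add_assoc, Finset.sum_range_add, Finset.sum_eq_zero, zero_add]
    · refine Finset.sum_congr rfl fun k _ => ?_
      have h5 := Nat.choose_mul (n := i + (M + 1)) (k := i + k) (s := i) (by omega)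
      rw [show i + (M + 1) - i = M + 1 by omega, show i + k - i = k by omega] at h5
      rw [show i + k - i = k by omega]
      have h6 : ((i + (M + 1)).choose (i + k) : ℤ) * ((i + k).choose i : ℤ) = ((i + (M + 1)).choose i : ℤ) * ((M + 1).choose k : ℤ) := by
        exact_mod_cast h5
      linear_combination (-1) ^ k * (i : ℤ) ^ j * h6
    · intro k hk
      simp only [Finset.mem_range] at hk
      rw [Nat.choose_eq_zero_of_lt hk]; simp
  rw [h4, ← Finset.mul_sum, h3, exLam, show i + m - i = m by omega, show i + (M + 1) - 1 - i = M by omega]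
  ring

lemma exLam_lucas (p u v x y : ℕ) [Fact p.Prime] (hx : x < p) (hy : y < p) :
    (((x + p * u).choose (y + p * v) : ℕ) : ℤ) ≡ (x.choose y : ℤ) * (u.choose v : ℤ) [ZMOD p] := by
  have h := Choose.choose_modEq_choose_mod_mul_choose_div (n := x + p * u) (k := y + p * v) (p := p)
  have hp : 0 < p := by omega
  rwa [Nat.add_mul_mod_self_left, Nat.add_mul_mod_self_left, Nat.mod_eq_of_lt hx, Nat.mod_eq_of_lt hy,
    Nat.add_mul_div_left _ _ hp, Nat.add_mul_div_left _ _ hp, Nat.div_eq_of_lt hx, Nat.div_eq_of_lt hy,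
    zero_add, zero_add] at h

lemma exLam_pred (p : ℕ) [hp : Fact p.Prime] (r : ℕ) (hr : r < p) :
    ((p - 1).choose r : ℤ) ≡ (-1) ^ r [ZMOD p] := by
  induction r with
  | zero => simp
  | succ r ih =>
    have h1 := ih (by omega)
    have h2 := hp.out.dvd_choose_self (k := r + 1) (by omega) hr
    have h3 := Nat.choose_succ_succ (p - 1) r
    rw [Nat.succ_eq_add_one, Nat.sub_add_cancel (by omega)] at h3
    rw [Nat.succ_eq_add_one, ] at h3
    rw [h3] at h2
    have h4 : (p : ℤ) ∣ ((p - 1).choose r : ℤ) + ((p - 1).choose (r + 1) : ℤ) := by exact_mod_cast h2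
    have h5 := h1.dvd
    rw [Int.modEq_iff_dvd]
    have : (-1 : ℤ) ^ (r + 1) - ((p - 1).choose (r + 1) : ℤ) =
      -(((p - 1).choose r : ℤ) + ((p - 1).choose (r + 1) : ℤ)) - ((-1) ^ r - ((p - 1).choose r : ℤ)) := by ring
    rw [this]
    exact dvd_sub ((dvd_neg).2 h4) h5

lemma exLam_iii (p b r k : ℕ) [hp : Fact p.Prime] (h5 : 5 ≤ p) (hr : r < p) (hk : k ≤ b) :
    exLam ((b + 1) * p) (b * p + r) (p * k) ≡ (-1) ^ (b + k) * ((b + 1).choose k : ℤ) [ZMOD p] := by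
  obtain ⟨d, rfl⟩ : ∃ d, b = k + d := ⟨b - k, by omega⟩
  have hodd : Odd p := hp.out.odd_of_ne_two (by omega)
  have e1 : (k + d) * p + r - p * k = r + p * d := by
    rw [show (k + d) * p + r = p * k + (r + p * d) by ring]; omega
  have e2 : (k + d + 1) * p - 1 - p * k = (p - 1) + p * d := by
    rw [show (k + d + 1) * p = p * k + p * d + p by ring]; omega
  have l1 := exLam_lucas p (k + d + 1) k 0 0 (by omega) (by omega)
  have l2 := exLam_lucas p d d (p - 1) r (by omega) hr
  have l3 := exLam_pred p r hr
  simp only [zero_add, Nat.choose_self, Nat.cast_one, one_mul, mul_one] at l1 l2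
  rw [exLam, e1, e2, mul_comm (k + d + 1) p]
  have := ((Int.ModEq.refl ((-1) ^ (r + p * d))).mul l1).mul (l2.trans l3)
  refine this.trans (congrArg (fun z : ℤ => z % (p : ℤ)) ?_)
  rw [pow_add, pow_mul, hodd.neg_one_pow]
  have s1 : (-1 : ℤ) ^ r * (-1) ^ r = 1 := by rw [← mul_pow]; simp
  have s2 : (-1 : ℤ) ^ k * (-1) ^ k = 1 := by rw [← mul_pow]; simp
  rw [show k + d + k = k + k + d by ring, pow_add, pow_add, s2]
  linear_combination (-1) ^ d * ((k + d + 1).choose k : ℤ) * s1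

lemma exLam_mul (N n i : ℕ) (hN : 0 < N) (hi : 0 < i) :
    (i : ℤ) * exLam N n i = N * ((-1) ^ (n - i) * ((N - 1).choose (i - 1) : ℤ) * ((N - 1 - i).choose (n - i) : ℤ)) := by
  have h := Nat.add_one_mul_choose_eq (N - 1) (i - 1)
  rw [Nat.sub_add_cancel hN, Nat.sub_add_cancel hi] at h
  have h' : (N : ℤ) * ((N - 1).choose (i - 1) : ℤ) = (N.choose i : ℤ) * i := by exact_mod_cast h
  rw [exLam]
  linear_combination -(-1) ^ (n - i) * ((N - 1 - i).choose (n - i) : ℤ) * h'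

lemma exLam_iv (p b n i : ℕ) [hp : Fact p.Prime] (hi : ¬ p ∣ i) :
    (p : ℤ) ∣ exLam ((b + 1) * p) n i := by
  have h0 : 0 < i := Nat.pos_of_ne_zero (by rintro rfl; simp at hi)
  have h := exLam_mul ((b + 1) * p) n i (Nat.mul_pos (by omega) hp.out.pos) h0
  have h1 : (p : ℤ) ∣ (i : ℤ) * exLam ((b + 1) * p) n i := by
    rw [h]; push_cast
    exact Dvd.dvd.mul_right (Dvd.intro_left _ rfl) _
  rcases (Nat.prime_iff_prime_int.1 hp.out).dvd_or_dvd h1 with h2 | h2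
  · exact absurd (by exact_mod_cast h2) hi
  · exact h2

lemma exLam_M (p b r a k : ℕ) [hp : Fact p.Prime] (h5 : 5 ≤ p) (hr : r < p) (ha : 0 < a) (hap : a < p)
    (hk : a + p * k ≤ b * p + r) :
    (-1) ^ (b * p + r - (a + p * k)) * (((b + 1) * p - 1).choose (a + p * k - 1) : ℤ) *
      (((b + 1) * p - 1 - (a + p * k)).choose (b * p + r - (a + p * k)) : ℤ) ≡
    (if a ≤ r then (-1) ^ (r - a) * (-1) ^ b * ((p - 1).choose (a - 1) : ℤ) * ((p - 1 - a).choose (r - a) : ℤ)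
      else 0) * ((-1) ^ k * (b.choose k : ℤ)) [ZMOD p] := by
  have hodd : Odd p := hp.out.odd_of_ne_two (by omega)
  have hkb : k ≤ b := by
    by_contra hc
    have : p * (b + 1) ≤ p * k := Nat.mul_le_mul_left _ (by omega)
    rw [Nat.mul_add, mul_comm p b] at this
    omega
  obtain ⟨d, rfl⟩ : ∃ d, b = k + d := ⟨b - k, by omega⟩
  have e1 : (k + d + 1) * p - 1 = (p - 1) + p * (k + d) := by
    rw [show (k + d + 1) * p = p * (k + d) + p by ring]; omega
  have e2 : (p - 1) + p * (k + d) - (a + p * k) = (p - 1 - a) + p * d := by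
    rw [Nat.mul_add]; omega
  have e3 : a + p * k - 1 = (a - 1) + p * k := by omega
  have l1 := exLam_lucas p (k + d) k (p - 1) (a - 1) (by omega) (by omega)
  rw [e1, e2, e3]
  split_ifs with har
  · have e4 : (k + d) * p + r - (a + p * k) = (r - a) + p * d := by
      rw [show (k + d) * p = p * k + p * d by ring]; omega
    have l2 := exLam_lucas p d d (p - 1 - a) (r - a) (by omega) (by omega)
    rw [e4]
    refine (((Int.ModEq.refl _).mul l1).mul l2).trans (congrArg (fun z : ℤ => z % (p : ℤ)) ?_)
    rw [pow_add, pow_mul, hodd.neg_one_pow, Nat.choose_self]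
    have s2 : (-1 : ℤ) ^ k * (-1) ^ k = 1 := by rw [← mul_pow]; simp
    rw [pow_add (-1 : ℤ) k d]
    push_cast
    linear_combination -(-1 : ℤ) ^ (r - a) * (-1) ^ d * ((p - 1).choose (a - 1) : ℤ) * ((k + d).choose k : ℤ) * ((p - 1 - a).choose (r - a) : ℤ) * s2
  · obtain ⟨e, rfl⟩ : ∃ e, d = e + 1 := by
      refine Nat.exists_eq_succ_of_ne_zero ?_
      rintro rfl
      rw [add_zero, mul_comm] at hk; omega
    have e4 : (k + (e + 1)) * p + r - (a + p * k) = (p + r - a) + p * e := by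
      rw [show (k + (e + 1)) * p = p * k + p * e + p by ring]; omega
    have l2 := exLam_lucas p (e + 1) e (p - 1 - a) (p + r - a) (by omega) (by omega)
    rw [Nat.choose_eq_zero_of_lt (show p - 1 - a < p + r - a by omega)] at l2
    rw [e4]
    refine ((Int.ModEq.refl _).mul l2).trans (congrArg (fun z : ℤ => z % (p : ℤ)) ?_)
    simp

lemma exLam_ii (p b r a j : ℕ) [hp : Fact p.Prime] (h5 : 5 ≤ p) (hb : 0 < b) (hr : r < p) (ha : 0 < a) (hap : a < p) :
    (p : ℤ) ^ 2 ∣ ∑ i ∈ (Finset.range (b * p + r + 1)).filter (fun i => i % p = a),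
      exLam ((b + 1) * p) (b * p + r) i * (i : ℤ) ^ j := by
  have hpp := Nat.prime_iff_prime_int.1 hp.out
  have hcop : IsCoprime ((p : ℤ) ^ 2) (a : ℤ) := by
    refine IsCoprime.pow_left ?_
    rw [Nat.isCoprime_iff_coprime]
    exact (Nat.coprime_of_lt_prime (by omega) hap hp.out)
  refine hcop.dvd_of_dvd_mul_left ?_
  rw [Finset.mul_sum]
  set c : ℤ := (if a ≤ r then (-1) ^ (r - a) * (-1) ^ b * ((p - 1).choose (a - 1) : ℤ) * ((p - 1 - a).choose (r - a) : ℤ)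
      else 0) with hc
  have key : ∀ i ∈ (Finset.range (b * p + r + 1)).filter (fun i => i % p = a),
      (p : ℤ) ^ 2 ∣ (a : ℤ) * (exLam ((b + 1) * p) (b * p + r) i * (i : ℤ) ^ j) -
        p * (b + 1) * a ^ j * c * ((-1) ^ (i / p) * (b.choose (i / p) : ℤ)) := by
    intro i hi
    simp only [Finset.mem_filter, Finset.mem_range] at hi
    obtain ⟨hi1, hi2⟩ := hi
    have hia : i = a + p * (i / p) := by rw [← hi2]; exact (Nat.mod_add_div i p).symm
    generalize i / p = k at *
    have hnd : ¬ p ∣ i := fun h => by rw [Nat.mod_eq_zero_of_dvd h] at hi2; omega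
    obtain ⟨μ, hμ⟩ := exLam_iv p b (b * p + r) i hnd
    have hM := (exLam_M p b r a k h5 hr ha hap (by omega)).dvd
    have hmul := exLam_mul ((b + 1) * p) (b * p + r) i (Nat.mul_pos (by omega) hp.out.pos) (by omega)
    rw [← hc, ← hia] at hM
    set M : ℤ := (-1) ^ (b * p + r - i) * (((b + 1) * p - 1).choose (i - 1) : ℤ) *
      (((b + 1) * p - 1 - i).choose (b * p + r - i) : ℤ)
    obtain ⟨t, ht⟩ := hM
    have hai : (p : ℤ) ∣ (a : ℤ) * (i : ℤ) ^ j - i * a ^ j := by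
      have : (i : ℤ) ≡ a [ZMOD p] := by
        rw [Int.modEq_iff_dvd, hia]; push_cast
        exact ⟨-k, by ring⟩
      have h := ((this.symm).mul (this.pow j)).symm.dvd
      exact h
    obtain ⟨s, hs⟩ := hai
    push_cast at hmul
    refine ⟨μ * s - (b + 1) * a ^ j * t, ?_⟩
    linear_combination (exLam ((b + 1) * p) (b * p + r) i) * hs + (p : ℤ) * s * hμ + (a : ℤ) ^ j * hmul - p * (b + 1) * a ^ j * ht
  have hs : ∑ i ∈ (Finset.range (b * p + r + 1)).filter (fun i => i % p = a),
      (p : ℤ) * (b + 1) * a ^ j * c * ((-1) ^ (i / p) * (b.choose (i / p) : ℤ)) = 0 := by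
    by_cases har : a ≤ r
    · rw [← Finset.mul_sum]
      have : ∑ i ∈ (Finset.range (b * p + r + 1)).filter (fun i => i % p = a),
          ((-1 : ℤ) ^ (i / p) * (b.choose (i / p) : ℤ)) = ∑ k ∈ Finset.range (b + 1), (-1) ^ k * (b.choose k : ℤ) := by
        refine Finset.sum_nbij' (fun i => i / p) (fun k => a + p * k) ?_ ?_ ?_ ?_ ?_
        · intro i hi
          simp only [Finset.mem_filter, Finset.mem_range] at hi ⊢
          rw [Nat.div_lt_iff_lt_mul (by omega), Nat.add_mul]; omega
        · intro k hk
          simp only [Finset.mem_filter, Finset.mem_range] at hk ⊢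
          refine ⟨?_, ?_⟩
          · have : p * k ≤ p * b := Nat.mul_le_mul_left _ (by omega)
            rw [mul_comm b p]; omega
          · rw [Nat.add_mul_mod_self_left, Nat.mod_eq_of_lt hap]
        · intro i hi
          simp only [Finset.mem_filter, Finset.mem_range] at hi
          have := Nat.mod_add_div i p
          rw [hi.2] at this; exact this
        · intro k hk
          rw [Nat.add_mul_div_left _ _ (by omega), Nat.div_eq_of_lt hap, zero_add]
        · intro i hi; rfl
      rw [this, Int.alternating_sum_range_choose_of_ne (by omega), mul_zero]
    · simp [hc, har]
  have := Finset.dvd_sum key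
  rwa [Finset.sum_sub_distrib, hs, sub_zero] at this


theorem existence_of_lambda (p : ℕ) [Fact p.Prime] (hp5 : 5 ≤ p)
    (n : ℕ) (hn1 : p ≤ n) (hn2 : n ≤ p ^ 2 - p - 1) :
    ∃ lam : ℕ → ℤ_[p],
      -- we may choose λ_{(b+1)p} = −1, where b = ⌊n/p⌋
      lam ((n / p + 1) * p) = -1 ∧
      -- (i) Σ_{i∈I} λ_i · i^j = 0 for all 0 ≤ j ≤ n
      (∀ j ≤ n,
        ∑ i ∈ insert ((n / p + 1) * p) (Finset.range (n + 1)),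
          lam i * (i : ℤ_[p]) ^ j = 0) ∧
      -- (ii) Σ_{i ≡ a mod p} λ_i · i^j ≡ 0 mod p² for each 0 ≤ a ≤ p − 1, 0 ≤ j ≤ n
      (∀ a < p, ∀ j ≤ n,
        (p : ℤ_[p]) ^ 2 ∣
          ∑ i ∈ (insert ((n / p + 1) * p) (Finset.range (n + 1))).filter
              (fun i => i % p = a),
            lam i * (i : ℤ_[p]) ^ j) ∧
      -- (iii) λ_i ≡ (−1)^{b − i/p} · C(b+1, i/p) mod p if p ∣ i
      -- (note that (−1)^{b − i/p} = (−1)^{b + i/p})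
      (∀ i ∈ insert ((n / p + 1) * p) (Finset.range (n + 1)), p ∣ i →
        (p : ℤ_[p]) ∣
          lam i - (-1) ^ (n / p + i / p) * ((n / p + 1).choose (i / p) : ℤ_[p])) ∧
      -- (iv) λ_i ≡ 0 mod p if p ∤ i
      (∀ i ∈ insert ((n / p + 1) * p) (Finset.range (n + 1)), ¬ p ∣ i →
        (p : ℤ_[p]) ∣ lam i) := by

  have hp : Fact p.Prime := inferInstance
  obtain ⟨b, hb⟩ : ∃ b, b = n / p := ⟨_, rfl⟩
  obtain ⟨r, hr⟩ : ∃ r, r = n % p := ⟨_, rfl⟩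
  have hrp : r < p := hr ▸ Nat.mod_lt _ (by omega)
  have hn : n = b * p + r := by rw [hb, hr, mul_comm]; exact (Nat.div_add_mod n p).symm
  have hb0 : 0 < b := by rw [hb]; exact Nat.div_pos hn1 (by omega)
  rw [← hb]
  clear hb hr hn1 hn2
  subst hn
  have hN : b * p + r < (b + 1) * p := by rw [Nat.add_mul]; omega
  set N := (b + 1) * p with hNdef
  set n := b * p + r with hndef
  have hnot : N ∉ Finset.range (n + 1) := by simp only [Finset.mem_range]; omega
  let L : ℕ → ℤ := fun i => if i = N then -1 else exLam N n i
  have hLN : L N = -1 := by simp [L]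
  have hLi : ∀ i ∈ Finset.range (n + 1), L i = exLam N n i := by
    intro i hi
    have : i ≠ N := by rintro rfl; exact hnot hi
    simp [L, this]
  have hi : ∀ j ≤ n, ∑ i ∈ insert N (Finset.range (n + 1)), L i * (i : ℤ) ^ j = 0 := by
    intro j hj
    rw [Finset.sum_insert hnot, hLN, Finset.sum_congr rfl (fun i hi => by rw [hLi i hi]),
      exLam_newton N n j hN hj]
    ring
  have hii : ∀ a < p, 0 < a → ∀ j ≤ n, (p : ℤ) ^ 2 ∣
      ∑ i ∈ (insert N (Finset.range (n + 1))).filter (fun i => i % p = a), L i * (i : ℤ) ^ j := by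
    intro a hap ha j hj
    have hNa : ¬ (N % p = a) := by rw [hNdef, Nat.mul_mod_left]; omega
    rw [Finset.filter_insert, if_neg hNa, Finset.sum_congr rfl (fun i hi => by
      rw [hLi i (Finset.mem_filter.1 hi).1])]
    exact exLam_ii p b r a j hp5 hb0 hrp ha hap
  have hii' : ∀ a < p, ∀ j ≤ n, (p : ℤ) ^ 2 ∣
      ∑ i ∈ (insert N (Finset.range (n + 1))).filter (fun i => i % p = a), L i * (i : ℤ) ^ j := by
    intro a hap j hj
    rcases Nat.eq_zero_or_pos a with rfl | ha
    · have h := Finset.sum_fiberwise_of_maps_to (s := insert N (Finset.range (n + 1)))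
        (t := Finset.range p) (g := fun i => i % p)
        (fun i _ => Finset.mem_range.2 (Nat.mod_lt _ hap)) (fun i => L i * (i : ℤ) ^ j)
      rw [hi j hj, ← Finset.add_sum_erase _ _ (Finset.mem_range.2 hap)] at h
      rw [eq_neg_of_add_eq_zero_left h, dvd_neg]
      refine Finset.dvd_sum fun a ha => ?_
      simp only [Finset.mem_erase, Finset.mem_range] at ha
      exact hii a ha.2 (by omega) j hj
    · exact hii a hap ha j hj
  refine ⟨fun i => (L i : ℤ_[p]), ?_, ?_, ?_, ?_, ?_⟩
  · simp [hLN]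
  · intro j hj
    have := congrArg (Int.castRingHom ℤ_[p]) (hi j hj)
    rw [map_sum, map_zero] at this
    rw [← this]
    refine Finset.sum_congr rfl fun i _ => ?_
    simp
  · intro a ha j hj
    have := map_dvd (Int.castRingHom ℤ_[p]) (hii' a ha j hj)
    simpa using this
  · intro i hiI hpi
    obtain ⟨k, rfl⟩ := hpi
    rw [Nat.mul_div_cancel_left _ hp.out.pos]
    have : (p : ℤ) ∣ L (p * k) - (-1) ^ (b + k) * ((b + 1).choose k : ℤ) := by
      rcases Finset.mem_insert.1 hiI with h | h
      · have hk : k = b + 1 := by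
          rw [hNdef, mul_comm] at h
          exact Nat.eq_of_mul_eq_mul_right hp.out.pos h
        rw [h, hLN, hk, Nat.choose_self]
        have : (-1 : ℤ) ^ (b + (b + 1)) = -1 := Odd.neg_one_pow ⟨b, by ring⟩
        rw [this]; simp
      · rw [hLi _ h]
        have hk : k ≤ b := by
          by_contra hc
          have h1 : p * (b + 1) ≤ p * k := Nat.mul_le_mul_left _ (by omega)
          rw [mul_comm p (b + 1)] at h1
          have := Finset.mem_range.1 h
          omega
        exact (exLam_iii p b r k hp5 hrp hk).symm.dvd
    have := map_dvd (Int.castRingHom ℤ_[p]) this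
    simpa using this
  · intro i hiI hpi
    have : (p : ℤ) ∣ L i := by
      rcases Finset.mem_insert.1 hiI with h | h
      · exact absurd (h ▸ Dvd.intro_left _ rfl) hpi
      · rw [hLi _ h]
        exact exLam_iv p b n i hpi
    have := map_dvd (Int.castRingHom ℤ_[p]) this
    simpa using this
end

section
/- Let c, n, i be integers with 0 ≤ i ≤ n < c. Then, as rational numbers, ∏_{i'=0, i'≠i}^{n} (c − i')/(i − i') = (−1)^{n−i} · (c/(c − i)) · C(c − 1, n) · C(n, i). -/
theorem prod_sub_eq_descFactorial (m k : ℕ) (h : k ≤ m) :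
    ∏ j ∈ Finset.range k, ((m : ℚ) - (j : ℚ)) = (m.descFactorial k : ℚ) := by
  induction k with
  | zero => simp
  | succ k ih =>
    rw [Finset.prod_range_succ, ih (by omega), Nat.descFactorial_succ, Nat.cast_mul,
      Nat.cast_sub (by omega)]
    ring

theorem vandermonde_product_formula (c n i : ℕ) (hi : i ≤ n) (hn : n < c) :
    ∏ i' ∈ (Finset.range (n + 1)).erase i,
      (((c : ℚ) - (i' : ℚ)) / ((i : ℚ) - (i' : ℚ))) =
      (-1 : ℚ) ^ (n - i) * ((c : ℚ) / ((c : ℚ) - (i : ℚ))) *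
        ((c - 1).choose n : ℚ) * (n.choose i : ℚ) := by
  induction n, hi using Nat.le_induction with
  | base =>
    have h1 : (Finset.range (i + 1)).erase i = Finset.range i := by
      ext x; simp only [Finset.mem_erase, Finset.mem_range]; omega
    have hc : (c : ℚ) - i ≠ 0 := by
      have : (i : ℚ) < c := by exact_mod_cast hn
      linarith
    rw [h1, Finset.prod_div_distrib, prod_sub_eq_descFactorial c i hn.le,
      prod_sub_eq_descFactorial i i le_rfl, Nat.descFactorial_self,
      Nat.descFactorial_eq_factorial_mul_choose]
    have hf : (i.factorial : ℚ) ≠ 0 := by exact_mod_cast i.factorial_ne_zero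
    obtain ⟨m, rfl⟩ : ∃ m, c = m + 1 := ⟨c - 1, by omega⟩
    have key : ((m : ℚ) + 1) * (m.choose i : ℚ) = ((m + 1).choose i : ℚ) * ((m : ℚ) + 1 - i) := by
      have h := Nat.add_one_mul_choose_eq m i
      have h2 := Nat.choose_succ_right_eq (m + 1) i
      rw [h2] at h
      have h3 : ((m + 1 - i : ℕ) : ℚ) = (m : ℚ) + 1 - i := by
        rw [Nat.cast_sub hn.le]; push_cast; ring
      rw [← h3]
      exact_mod_cast h
    push_cast at hc ⊢
    simp only [Nat.sub_self, pow_zero, one_mul, Nat.choose_self, Nat.cast_one, mul_one,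
      Nat.add_sub_cancel]
    field_simp
    linear_combination -key
  | succ n hin ih =>
    have h1 : (Finset.range (n + 1 + 1)).erase i
        = insert (n + 1) ((Finset.range (n + 1)).erase i) := by
      ext x; simp only [Finset.mem_erase, Finset.mem_range, Finset.mem_insert]; omega
    rw [h1, Finset.prod_insert (by simp), ih (by omega)]
    have e1 : ((c - 1).choose (n + 1) : ℚ) * (n + 1) = ((c - 1).choose n : ℚ) * (c - (n + 1)) := by
      have h := Nat.choose_succ_right_eq (c - 1) n
      have h3 : ((c - 1 - n : ℕ) : ℚ) = (c : ℚ) - (n + 1) := by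
        rw [show c - 1 - n = c - (n + 1) by omega, Nat.cast_sub hn.le]; push_cast; ring
      rw [← h3]
      exact_mod_cast h
    have e2 : ((n + 1).choose i : ℚ) * (n + 1 - i) = (n.choose i : ℚ) * (n + 1) := by
      have h := Nat.choose_mul_succ_eq n i
      have h3 : ((n + 1 - i : ℕ) : ℚ) = (n : ℚ) + 1 - i := by
        rw [Nat.cast_sub (by omega)]; push_cast; ring
      rw [← h3]
      exact_mod_cast h.symm
    have hle : (i : ℚ) ≤ n := by exact_mod_cast hin
    have hd : (i : ℚ) - ((n + 1 : ℕ) : ℚ) ≠ 0 := by push_cast; linarith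
    have hn1 : (n : ℚ) + 1 ≠ 0 := by positivity
    rw [show n + 1 - i = (n - i) + 1 by omega, pow_succ, div_mul_eq_mul_div, div_eq_iff hd]
    apply mul_right_cancel₀ hn1
    push_cast
    generalize (c : ℚ) / ((c : ℚ) - i) = K
    generalize (-1 : ℚ) ^ (n - i) = s
    linear_combination (-(s * K * ((n + 1).choose i : ℚ) * (n + 1 - i))) * e1
      - s * K * ((c - 1).choose n : ℚ) * (c - (n + 1)) * e2
end

section
/- Let p be a prime, let b, ε be integers with 1 ≤ b ≤ p − 2 and 0 ≤ ε ≤ p − 1, and set n = bp + ε. Then for every integer a with 1 ≤ a ≤ p − 1 and every integer j ≥ 0, the rational number Σ_{0 ≤ i ≤ n, i ≡ a mod p} (−1)^i · i^j · C(n, i) / ((b+1)p − i) is zero or has p-adic valuation at least 1. -/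
/-- Rationals of the form `p * m / d` with `d` prime to `p`. -/
def PDivRat (p : ℕ) (x : ℚ) : Prop :=
  ∃ m d : ℤ, ¬ (p : ℤ) ∣ d ∧ x * d = p * m

theorem PDivRat.add {p : ℕ} (hp : p.Prime) {x y : ℚ} (hx : PDivRat p x) (hy : PDivRat p y) :
    PDivRat p (x + y) := by
  obtain ⟨m, d, hd, h⟩ := hx
  obtain ⟨m', d', hd', h'⟩ := hy
  refine ⟨m * d' + m' * d, d * d', ?_, ?_⟩
  · intro hh
    rcases (Nat.prime_iff_prime_int.mp hp).dvd_or_dvd hh with h1 | h1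
    · exact hd h1
    · exact hd' h1
  · push_cast
    linear_combination (d' : ℚ) * h + (d : ℚ) * h'

theorem PDivRat.sum {p : ℕ} (hp : p.Prime) (s : Finset ℕ) (f : ℕ → ℚ)
    (h : ∀ i ∈ s, PDivRat p (f i)) : PDivRat p (∑ i ∈ s, f i) := by
  refine Finset.sum_induction f (PDivRat p) (fun _ _ => PDivRat.add hp) ?_ h
  refine ⟨0, 1, ?_, by simp⟩
  intro hh
  exact (Nat.prime_iff_prime_int.mp hp).not_isUnit (isUnit_of_dvd_one hh)

theorem PDivRat.ratCong {p : ℕ} (hp : p.Prime) {x : ℚ} (hx : PDivRat p x) :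
    RatCong p 1 x 0 := by
  haveI := Fact.mk hp
  obtain ⟨m, d, hd, h⟩ := hx
  by_cases hx0 : x = 0
  · exact Or.inl hx0
  right
  have hd0 : d ≠ 0 := by rintro rfl; simp at hd
  have hdq : (d : ℚ) ≠ 0 := by exact_mod_cast hd0
  have hpq : (p : ℚ) ≠ 0 := by exact_mod_cast hp.ne_zero
  have hm : (m : ℚ) ≠ 0 := by
    intro hm
    rw [hm, mul_zero] at h
    exact (mul_ne_zero hx0 hdq) h
  have hv := congrArg (padicValRat p) h
  rw [padicValRat.mul hx0 hdq, padicValRat.mul hpq hm, padicValRat.of_int, padicValRat.of_int,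
    padicValInt.eq_zero_of_not_dvd hd, padicValRat.self hp.one_lt] at hv
  rw [sub_zero]
  push_cast at *
  omega

theorem alt_sum_residue (p : ℕ) (hp : p.Prime)
    (b ε : ℕ) (hb1 : 1 ≤ b) (hb2 : b ≤ p - 2) (hε : ε ≤ p - 1)
    (a : ℕ) (ha2 : a ≤ p - 1) :
    (p : ℤ) ∣ ∑ i ∈ (Finset.range (b * p + ε + 1)).filter (fun i => i % p = a),
        (-1 : ℤ) ^ i * ((b * p + ε).choose i : ℤ) := by
  haveI := Fact.mk hp
  have hp0 := hp.pos
  have hodd : Odd p := hp.odd_of_ne_two (by omega)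
  have e1 : ∑ i ∈ (Finset.range (b * p + ε + 1)).filter (fun i => i % p = a),
        (-1 : ℤ) ^ i * ((b * p + ε).choose i : ℤ)
      = ∑ i ∈ (Finset.range ((b + 1) * p)).filter (fun i => i % p = a),
        (-1 : ℤ) ^ i * ((b * p + ε).choose i : ℤ) := by
    apply Finset.sum_subset
    · intro i hi
      simp only [Finset.mem_filter, Finset.mem_range] at *
      refine ⟨?_, hi.2⟩
      have : (b + 1) * p = b * p + p := by ring
      omega
    · intro i hi hi'
      simp only [Finset.mem_filter, Finset.mem_range] at *
      rw [Nat.choose_eq_zero_of_lt]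
      · simp
      · by_contra hc
        exact hi' ⟨by omega, hi.2⟩
  have e2 : (Finset.range ((b + 1) * p)).filter (fun i => i % p = a)
      = (Finset.range (b + 1)).image (fun k => a + p * k) := by
    ext i
    simp only [Finset.mem_filter, Finset.mem_range, Finset.mem_image]
    constructor
    · rintro ⟨h1, h2⟩
      refine ⟨i / p, Nat.div_lt_of_lt_mul (by rwa [mul_comm]), ?_⟩
      rw [← h2]; exact Nat.mod_add_div i p
    · rintro ⟨k, hk, rfl⟩
      refine ⟨?_, ?_⟩
      · have : (k + 1) * p ≤ (b + 1) * p := Nat.mul_le_mul_right _ hk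
        have h3 : (k + 1) * p = p * k + p := by ring
        omega
      · rw [Nat.add_mul_mod_self_left, Nat.mod_eq_of_lt (by omega)]
  rw [e1, e2, Finset.sum_image (by
    intro x _ y _ hxy
    have : p * x = p * y := by simpa using hxy
    exact Nat.eq_of_mul_eq_mul_left hp0 this)]
  have key : ∀ k ∈ Finset.range (b + 1),
      (-1 : ℤ) ^ (a + p * k) * ((b * p + ε).choose (a + p * k) : ℤ) ≡
        ((-1) ^ a * (ε.choose a : ℤ)) * ((-1) ^ k * (b.choose k : ℤ)) [ZMOD p] := by
    intro k _
    have hl := Choose.choose_modEq_choose_mod_mul_choose_div (p := p) (n := b * p + ε)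
      (k := a + p * k)
    have m1 : (b * p + ε) % p = ε := by
      rw [mul_comm, Nat.mul_add_mod, Nat.mod_eq_of_lt (by omega)]
    have m2 : (b * p + ε) / p = b := by
      rw [mul_comm, Nat.mul_add_div hp0, Nat.div_eq_of_lt (by omega), add_zero]
    have m3 : (a + p * k) % p = a := by
      rw [Nat.add_mul_mod_self_left, Nat.mod_eq_of_lt (by omega)]
    have m4 : (a + p * k) / p = k := by
      rw [Nat.add_mul_div_left _ _ hp0, Nat.div_eq_of_lt (by omega), zero_add]
    rw [m1, m2, m3, m4] at hl
    have hs : (-1 : ℤ) ^ (a + p * k) = (-1) ^ a * (-1) ^ k := by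
      rw [pow_add, pow_mul, hodd.neg_one_pow]
    rw [hs]
    have := hl.mul_left ((-1 : ℤ) ^ a * (-1) ^ k)
    refine this.trans ?_
    push_cast
    have e : (-1 : ℤ) ^ a * (-1) ^ k * ((ε.choose a : ℤ) * (b.choose k : ℤ)) =
      ((-1) ^ a * (ε.choose a : ℤ)) * ((-1) ^ k * (b.choose k : ℤ)) := by ring
    rw [e]
  have hsum : ∑ k ∈ Finset.range (b + 1), (-1 : ℤ) ^ (a + p * k) * ((b * p + ε).choose (a + p * k) : ℤ) ≡
      ∑ k ∈ Finset.range (b + 1), ((-1) ^ a * (ε.choose a : ℤ)) * ((-1) ^ k * (b.choose k : ℤ)) [ZMOD p] := by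
    apply Int.ModEq.symm
    rw [Int.modEq_iff_dvd, ← Finset.sum_sub_distrib]
    exact Finset.dvd_sum fun k hk => (Int.modEq_iff_dvd.mp (key k hk).symm)
  rw [← Finset.mul_sum, Int.alternating_sum_range_choose_of_ne (by omega), mul_zero] at hsum
  exact (Int.modEq_zero_iff_dvd).mp hsum

theorem sum_over_residue_class_divisible (p : ℕ) (hp : p.Prime)
    (b ε : ℕ) (hb1 : 1 ≤ b) (hb2 : b ≤ p - 2) (hε : ε ≤ p - 1)
    (a : ℕ) (ha1 : 1 ≤ a) (ha2 : a ≤ p - 1) (j : ℕ) :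
    RatCong p 1
      (∑ i ∈ (Finset.range (b * p + ε + 1)).filter (fun i => i % p = a),
        (-1 : ℚ) ^ i * (i : ℚ) ^ j * ((b * p + ε).choose i : ℚ) /
          (((b + 1 : ℕ) * p : ℚ) - (i : ℚ)))
      0 := by
  apply PDivRat.ratCong hp
  have hpa : ¬ (p : ℤ) ∣ (a : ℤ) := by
    intro h
    have := Nat.le_of_dvd ha1 (Int.natCast_dvd_natCast.mp h)
    have := hp.pos
    omega
  have haq : (a : ℚ) ≠ 0 := by exact_mod_cast (by omega : a ≠ 0)
  obtain ⟨S, hS⟩ := alt_sum_residue p hp b ε hb1 hb2 hε a ha2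
  have hSq : ∑ i ∈ (Finset.range (b * p + ε + 1)).filter (fun i => i % p = a),
        (-1 : ℚ) ^ i * ((b * p + ε).choose i : ℚ) = p * S := by exact_mod_cast hS
  have hdec : (∑ i ∈ (Finset.range (b * p + ε + 1)).filter (fun i => i % p = a),
        (-1 : ℚ) ^ i * (i : ℚ) ^ j * ((b * p + ε).choose i : ℚ) /
          (((b + 1 : ℕ) * p : ℚ) - (i : ℚ)))
      = (∑ i ∈ (Finset.range (b * p + ε + 1)).filter (fun i => i % p = a),
        ((-1 : ℚ) ^ i * (i : ℚ) ^ j * ((b * p + ε).choose i : ℚ) /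
          (((b + 1 : ℕ) * p : ℚ) - (i : ℚ)) +
          ((a : ℚ) ^ j / a) * ((-1 : ℚ) ^ i * ((b * p + ε).choose i : ℚ))))
        + (-((a : ℚ) ^ j / a)) * (p * S) := by
    rw [Finset.sum_add_distrib, ← Finset.mul_sum, hSq]
    ring
  rw [hdec]
  apply PDivRat.add hp
  · apply PDivRat.sum hp
    intro i hi
    have him : i % p = a := (Finset.mem_filter.mp hi).2
    have hia : (i : ℤ) = a + p * (i / p : ℕ) := by
      rw [← him]; exact_mod_cast (Nat.mod_add_div i p).symm
    generalize hq : i / p = q at hia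
    have hd : ¬ (p : ℤ) ∣ ((b + 1 : ℤ) * p - i) := by
      intro h
      apply hpa
      have : (a : ℤ) = p * ((b + 1) - q) - ((b + 1 : ℤ) * p - i) := by rw [hia]; ring
      rw [this]
      exact dvd_sub (dvd_mul_right _ _) h
    have hd0 : (((b + 1 : ℕ) * p : ℚ) - (i : ℚ)) ≠ 0 := by
      intro h
      apply hd
      have : ((b + 1 : ℤ) * p - i) = 0 := by
        have h' : (((b + 1 : ℤ) * p - i : ℤ) : ℚ) = 0 := by push_cast at *; exact h
        exact_mod_cast h'
      rw [this]; exact dvd_zero _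
    have hdiv : (p : ℤ) ∣ (a * i ^ j + a ^ j * ((b + 1 : ℤ) * p - i)) := by
      have h1 : (p : ℤ) ∣ (i : ℤ) - a := ⟨q, by rw [hia]; ring⟩
      have h2 : (p : ℤ) ∣ (i : ℤ) ^ j - a ^ j := h1.trans (sub_dvd_pow_sub_pow _ _ _)
      have e : ((a : ℤ) * i ^ j + a ^ j * ((b + 1 : ℤ) * p - i)) =
        a * ((i : ℤ) ^ j - a ^ j) - a ^ j * (i - a) + p * (a ^ j * (b + 1)) := by ring
      rw [e]
      exact dvd_add (dvd_sub (h2.mul_left _) (h1.mul_left _)) (dvd_mul_right _ _)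
    obtain ⟨t, ht⟩ := hdiv
    refine ⟨(-1) ^ i * ((b * p + ε).choose i : ℤ) * t, ((b + 1 : ℤ) * p - i) * a, ?_, ?_⟩
    · intro hh
      rcases (Nat.prime_iff_prime_int.mp hp).dvd_or_dvd hh with h1 | h1
      · exact hd h1
      · exact hpa h1
    · have htq : ((a : ℚ) * i ^ j + a ^ j * ((b + 1 : ℚ) * p - i)) = p * t := by
        exact_mod_cast ht
      push_cast at *
      field_simp
      linear_combination (((b * p + ε).choose i : ℚ)) * htq
  · refine ⟨-(a ^ j) * S, a, hpa, ?_⟩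
    push_cast
    field_simp
end

section
/- Let p be a prime and let r, n be integers with p ≤ r ≤ p² − p − 1 and n ≤ r. Set b = ⌊n/p⌋ and suppose 2n ≥ r + 2b + 2 (i.e., n ≥ r/2 + b + 1). Then 2·(n − v_p([n]_{b+1})) > r, where [n]_{b+1} = n·(n−1)···(n−b). -/
theorem n_minus_val_gt_half_r (p : ℕ) (hp : p.Prime) (r n : ℕ)
    (hr1 : p ≤ r) (hr2 : r ≤ p ^ 2 - p - 1) (hn : n ≤ r)
    (hge : r + 2 * (n / p) + 2 ≤ 2 * n) :
    (r : ℤ) < 2 * ((n : ℤ) - (padicValNat p (n.descFactorial (n / p + 1)) : ℤ)) := by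
  have : Fact p.Prime := ⟨hp⟩
  have hp2 := hp.two_le
  have hlt : n < p ^ 2 := by omega
  have hlog : Nat.log p n < 2 := Nat.log_lt_of_lt_pow (by omega) hlt
  have hfac : padicValNat p n.factorial = n / p := by
    rw [padicValNat_factorial hlog]
    simp
  have hdvd : n.descFactorial (n / p + 1) ∣ n.factorial :=
    ⟨_, by rw [mul_comm]; exact (Nat.factorial_mul_descFactorial (by omega)).symm⟩
  have hle : padicValNat p (n.descFactorial (n / p + 1)) ≤ n / p := by
    refine le_trans ?_ hfac.le
    exact (padicValNat_dvd_iff_le (Nat.factorial_ne_zero n)).1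
      (pow_padicValNat_dvd.trans hdvd)
  omega
end

section
/- Let p be a prime and let r, n be integers with p ≤ r ≤ p² − p − 1 and n ≤ r. Set b = ⌊n/p⌋, suppose 2n ≥ r + 2b + 2, and let v = v_p([n]_{b+1}) where [n]_{b+1} = n·(n−1)···(n−b). Then for every integer l ≥ 1, one has p^{2n − r − v + l} > n + l. -/
theorem pow_gt_n_add_l (p : ℕ) (hp : p.Prime) (r n : ℕ)
    (hr1 : p ≤ r) (hr2 : r ≤ p ^ 2 - p - 1) (hn : n ≤ r)
    (hge : r + 2 * (n / p) + 2 ≤ 2 * n) (l : ℕ) (hl : 1 ≤ l) :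
    ((n : ℚ) + (l : ℚ)) <
      (p : ℚ) ^ (2 * (n : ℤ) - (r : ℤ) -
        (padicValNat p (n.descFactorial (n / p + 1)) : ℤ) + (l : ℤ)) := by
  haveI := Fact.mk hp
  have h2 := hp.two_le
  have hnp : n < p ^ 2 := by omega
  have hn0 : n ≠ 0 := by omega
  have hfac : padicValNat p n.factorial = n / p := by
    rw [padicValNat_factorial (p := p) (n := n) (b := 2) (Nat.log_lt_of_lt_pow hn0 hnp)]
    simp
  have hle : n / p + 1 ≤ n := by omega
  have hv : padicValNat p (n.descFactorial (n / p + 1)) ≤ n / p := by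
    refine le_of_le_of_eq ?_ hfac
    apply (padicValNat_dvd_iff_le (Nat.factorial_ne_zero n)).1
    exact pow_padicValNat_dvd.trans
      ⟨(n - (n / p + 1)).factorial, by rw [mul_comm, Nat.factorial_mul_descFactorial hle]⟩
  generalize padicValNat p (n.descFactorial (n / p + 1)) = v at hv ⊢
  have hkey : n + l < p ^ (2 + l) := by
    have : l < p ^ l := Nat.lt_pow_self hp.one_lt
    rw [pow_add]
    nlinarith
  have h1 : ((n : ℚ) + (l : ℚ)) < (p : ℚ) ^ ((2 + l : ℕ) : ℤ) := by
    rw [zpow_natCast]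
    exact_mod_cast hkey
  refine h1.trans_le (zpow_le_zpow_right₀ (by exact_mod_cast hp.one_lt.le) ?_)
  push_cast
  omega
end

section
/- Let p ≥ 5 be a prime and let r, n be integers with p ≤ r ≤ p² − p − 1 and n ≤ r. Set b = ⌊n/p⌋, suppose 2n ≥ r + 2b + 2, and let v = v_p([n]_{b+1}) where [n]_{b+1} = n·(n−1)···(n−b). Then for every integer l ≥ 1, one has (p − 1)·(2(n − 1 + l) − r − v) > n − 1 + l. -/
theorem linear_estimate (p : ℕ) (hp : p.Prime) (hp5 : 5 ≤ p) (r n : ℕ)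
    (hr1 : p ≤ r) (hr2 : r ≤ p ^ 2 - p - 1) (hn : n ≤ r)
    (hge : r + 2 * (n / p) + 2 ≤ 2 * n) (l : ℕ) (hl : 1 ≤ l) :
    ((n : ℤ) - 1 + (l : ℤ)) <
      ((p : ℤ) - 1) * (2 * ((n : ℤ) - 1 + (l : ℤ)) - (r : ℤ) -
        (padicValNat p (n.descFactorial (n / p + 1)) : ℤ)) := by
  haveI : Fact p.Prime := ⟨hp⟩
  have hfac : ∀ m, m < p ^ 2 → padicValNat p m.factorial = m / p := by
    intro m hm
    have h := padicValNat_factorial (p := p) (n := m) (b := 2)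
      (Nat.log_lt_of_lt_pow' (by norm_num) hm)
    rw [h]
    simp
  have hpp : p ^ 2 = p * p := sq p
  have h5 : 5 * p ≤ p * p := Nat.mul_le_mul_right p hp5
  have hnp : n < p ^ 2 - p := by omega
  have hdiv : p * (n / p) + n % p = n := Nat.div_add_mod n p
  have hmod : n % p < p := Nat.mod_lt _ (by omega)
  generalize hb : n / p = b at *
  have hbn : b + 1 ≤ n := by omega
  have hbp : b + 2 ≤ p := by
    by_contra hcon
    have : p * (p - 1) ≤ p * b := Nat.mul_le_mul_left p (by omega)
    rw [Nat.mul_sub] at this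
    omega
  have hv := Nat.factorial_mul_descFactorial hbn
  have hv2 : padicValNat p (n - (b + 1)).factorial
      + padicValNat p (n.descFactorial (b + 1)) = b := by
    rw [← padicValNat.mul (Nat.factorial_ne_zero _), hv, hfac n (by omega), hb]
    intro h0
    rw [Nat.descFactorial_eq_zero_iff_lt] at h0
    omega
  rw [hfac _ (by omega)] at hv2
  have hlow : b - 1 ≤ (n - (b + 1)) / p := by
    rw [Nat.le_div_iff_mul_le (by omega), mul_comm, Nat.mul_sub]
    omega
  generalize padicValNat p (n.descFactorial (b + 1)) = v at *
  have hnn : n ≤ p * b + p - 1 := by omega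
  have hv1 : v ≤ 1 := by omega
  have hvb : v ≤ b := by omega
  obtain ⟨k, rfl⟩ : ∃ k, l = k + 1 := ⟨l - 1, by omega⟩
  have e1 : (2 * b + 2 - v + 2 * k : ℤ) ≤ 2 * ((n : ℤ) - 1 + ((k + 1 : ℕ) : ℤ)) - r - v := by
    push_cast; omega
  have e2 := mul_le_mul_of_nonneg_left e1 (show (0:ℤ) ≤ (p:ℤ) - 1 by omega)
  refine lt_of_lt_of_le ?_ e2
  have hn' : (n : ℤ) ≤ p * b + p - 1 := by
    have : n + 1 ≤ p * b + p := by omega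
    have h' : ((n + 1 : ℕ) : ℤ) ≤ ((p * b + p : ℕ) : ℤ) := by exact_mod_cast this
    push_cast at h'; linarith
  push_cast
  have hP : (5:ℤ) ≤ p := by exact_mod_cast hp5
  have hk : (0:ℤ) ≤ k := by positivity
  have hk2 := mul_nonneg (sub_nonneg.2 hP) hk
  rcases Nat.eq_zero_or_pos b with h0 | h0
  · have : v = 0 := by omega
    subst h0 this
    push_cast at *
    nlinarith
  · have hB : (1:ℤ) ≤ b := by exact_mod_cast h0
    have hV : (v:ℤ) ≤ 1 := by exact_mod_cast hv1
    nlinarith [mul_nonneg (sub_nonneg.2 hP) (sub_nonneg.2 hB), mul_nonneg (sub_nonneg.2 hP) (sub_nonneg.2 hV)]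
end

section
/- Let p ≥ 5 be a prime and let r ≥ p be an integer. Then p^{r − 2·v_p(r!)} > (r + 1)². -/
theorem pow_gt_sq_aux (p : ℕ) (hp : p.Prime) (hp5 : 5 ≤ p) (r : ℕ) (hr : p ≤ r) :
    ∃ e : ℕ, e + 2 * padicValNat p r.factorial = r ∧ (r + 1) ^ 2 < p ^ e := by
  induction r using Nat.strong_induction_on with
  | _ r ih =>
  haveI : Fact p.Prime := ⟨hp⟩
  have hp0 : 0 < p := by omega
  have hq1 : 1 ≤ r / p := Nat.div_pos hr hp0
  have hs : r % p < p := Nat.mod_lt _ hp0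
  have hqr : r / p < r := Nat.div_lt_self (by omega) (by omega)
  have hdm : p * (r / p) + r % p = r := Nat.div_add_mod r p
  have hv : padicValNat p r.factorial = padicValNat p (r / p).factorial + r / p := by
    rw [← padicValNat_factorial_mul, padicValNat_mul_div_factorial]
  have ih' := ih (r / p) hqr
  clear ih
  generalize r / p = q at *
  generalize r % p = s at *
  obtain ⟨k, rfl⟩ : ∃ k, p = k + 5 := ⟨p - 5, by omega⟩
  have hle : r + 1 ≤ (k + 5) * (q + 1) := by rw [mul_add]; omega
  have hsq : (r + 1) ^ 2 ≤ (k + 5) ^ 2 * (q + 1) ^ 2 := by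
    rw [← mul_pow]; exact Nat.pow_le_pow_left hle 2
  rw [hv]
  by_cases hq : k + 5 ≤ q
  · obtain ⟨e, he, hlt⟩ := ih' hq
    refine ⟨e + (k + 2) * q + s, by nlinarith, ?_⟩
    calc (r + 1) ^ 2 ≤ (k + 5) ^ 2 * (q + 1) ^ 2 := hsq
      _ < (k + 5) ^ 2 * (k + 5) ^ e := by gcongr
      _ = (k + 5) ^ (2 + e) := by rw [pow_add]
      _ ≤ _ := Nat.pow_le_pow_right hp0 (by nlinarith)
  · have h0 : padicValNat (k + 5) q.factorial = 0 := by
      apply padicValNat.eq_zero_of_not_dvd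
      rw [hp.dvd_factorial]; exact hq
    rw [h0]
    refine ⟨(k + 3) * q + s, by nlinarith, ?_⟩
    rcases Nat.lt_or_ge q 2 with h2 | h2
    · obtain rfl : q = 1 := by omega
      calc (r + 1) ^ 2 ≤ (k + 5) ^ 2 * (1 + 1) ^ 2 := hsq
        _ < (k + 5) ^ 2 * (k + 5) := by gcongr; omega
        _ = (k + 5) ^ 3 := by ring
        _ ≤ _ := Nat.pow_le_pow_right hp0 (by nlinarith)
    · calc (r + 1) ^ 2 ≤ (k + 5) ^ 2 * (q + 1) ^ 2 := hsq
        _ ≤ (k + 5) ^ 2 * (k + 5) ^ 2 :=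
          Nat.mul_le_mul_left _ (Nat.pow_le_pow_left (by omega) 2)
        _ = (k + 5) ^ 4 := by ring
        _ < _ := Nat.pow_lt_pow_right (by omega) (by nlinarith)

theorem pow_gt_sq (p : ℕ) (hp : p.Prime) (hp5 : 5 ≤ p) (r : ℕ) (hr : p ≤ r) :
    ((r : ℚ) + 1) ^ 2 < (p : ℚ) ^ ((r : ℤ) - 2 * (padicValNat p r.factorial : ℤ)) := by
  obtain ⟨e, he, hlt⟩ := pow_gt_sq_aux p hp hp5 r hr
  have h : (r : ℤ) - 2 * (padicValNat p r.factorial : ℤ) = (e : ℤ) := by omega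
  rw [h, zpow_natCast]
  exact_mod_cast hlt
end

section
/- Let p be a prime and let r, n be integers with p ≤ r ≤ p² − p − 1 and n ≤ r. Set b = ⌊n/p⌋, suppose 2n ≥ r + 2b + 2, and let v = v_p([n]_{b+1}) where [n]_{b+1} = n·(n−1)···(n−b). Then for every integer j with 0 ≤ j ≤ n − 1 and every integer l ≥ n − j, one has 2·(v + ⌊log_p l⌋) ≤ 2(l + j) − r, where ⌊log_p l⌋ is the integer part of the base-p logarithm of l. -/
lemma log_add_le_aux (p m d : ℕ) (hp : 1 < p) : Nat.log p (m + d) ≤ Nat.log p m + d := by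
  induction d with
  | zero => simp
  | succ d ih =>
    have h : Nat.log p (m + (d + 1)) ≤ Nat.log p (m + d) + 1 := by
      rcases Nat.eq_zero_or_pos (m + d) with h0 | h0
      · have h1 : m + (d + 1) = 1 := by omega
        rw [h1]; simp
      · rw [← Nat.log_mul_base hp h0.ne']
        apply Nat.log_mono_right
        nlinarith
    omega

theorem val_plus_log_estimate (p : ℕ) (hp : p.Prime) (r n : ℕ)
    (hr1 : p ≤ r) (hr2 : r ≤ p ^ 2 - p - 1) (hn : n ≤ r)
    (hge : r + 2 * (n / p) + 2 ≤ 2 * n)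
    (j : ℕ) (hj : j ≤ n - 1) (l : ℕ) (hl : n - j ≤ l) :
    2 * ((padicValNat p (n.descFactorial (n / p + 1)) : ℤ) + (Nat.log p l : ℤ)) ≤
      2 * ((l : ℤ) + (j : ℤ)) - (r : ℤ) := by
  have hp2 := hp.two_le
  haveI : Fact p.Prime := ⟨hp⟩
  have hlt : n < (p - 1) * p := by
    have : (p - 1) * p = p ^ 2 - p := by rw [Nat.sub_mul, pow_two, one_mul]
    omega
  have hb : n / p < p - 1 := (Nat.div_lt_iff_lt_mul hp.pos).2 hlt
  have hbn : n / p + 1 ≤ n := by omega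
  have hlog1 : Nat.log p n ≤ 1 := by
    have : Nat.log p n < 2 := by
      apply Nat.log_lt_of_lt_pow (by omega)
      have : (p - 1) * p ≤ p ^ 2 := by rw [pow_two]; exact Nat.mul_le_mul_right _ (by omega)
      omega
    omega
  have hlogb : Nat.log p n ≤ n / p := by
    rcases Nat.lt_or_ge n p with h | h
    · rw [Nat.log_of_lt h]; omega
    · have := Nat.div_pos h hp.pos
      omega
  have hv : padicValNat p (n.descFactorial (n / p + 1)) ≤ Nat.log p n := by
    rw [Nat.descFactorial_eq_factorial_mul_choose,
      padicValNat.mul (Nat.factorial_ne_zero _) (Nat.choose_pos hbn).ne',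
      padicValNat.eq_zero_of_not_dvd (n := (n / p + 1).factorial)
        (by rw [hp.dvd_factorial]; omega), zero_add, ← Nat.factorization_def _ hp]
    exact Nat.factorization_choose_le_log
  have hl2 := log_add_le_aux p (n - j) (l - (n - j)) (by omega)
  rw [Nat.add_sub_cancel' hl] at hl2
  have hl3 : Nat.log p (n - j) ≤ Nat.log p n := Nat.log_mono_right (by omega)
  omega
end

section
/- Let p be a prime and let ε be an integer with 0 ≤ ε ≤ p − 1. Then C(p − 1, ε) ≡ (−1)^ε · (1 − p·H_ε) mod p², as rational numbers. -/
theorem choose_aux (p : ℕ) (hp : p.Prime) (ε : ℕ) (hε : ε ≤ p - 1) :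
    ∃ a h d : ℤ, ¬ (p : ℤ) ∣ d ∧ harmonic ε * d = h ∧
      (((p - 1).choose ε : ℚ) - (-1 : ℚ) ^ ε * (1 - (p : ℚ) * harmonic ε)) * d
        = (p : ℚ) ^ 2 * a := by
  induction ε with
  | zero =>
    refine ⟨0, 0, 1, ?_, by simp, by simp⟩
    intro h
    have h2 := Int.le_of_dvd one_pos h
    have := hp.two_le
    omega
  | succ e ih =>
    obtain ⟨a, h, d, hd, hh, ha⟩ := ih (by omega)
    refine ⟨(-1) ^ (e + 1) * h - a * ((e : ℤ) + 1 - p), h * (e + 1) + d, d * (e + 1), ?_, ?_, ?_⟩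
    · intro hdv
      rcases (Nat.prime_iff_prime_int.mp hp).dvd_or_dvd hdv with h1 | h1
      · exact hd h1
      · have h2 := Int.le_of_dvd (by positivity) h1
        have := hp.two_le
        omega
    · have he : ((e : ℚ) + 1) ≠ 0 := by positivity
      rw [harmonic_succ]
      push_cast
      rw [← hh]
      field_simp
    · have he : ((e : ℚ) + 1) ≠ 0 := by positivity
      have hc : ((p - 1).choose (e + 1) : ℚ) * (e + 1) = (p - 1).choose e * ((p : ℚ) - 1 - e) := by
        have h3 := Nat.choose_succ_right_eq (p - 1) e
        have h4 : ((p - 1 - e : ℕ) : ℚ) = (p : ℚ) - 1 - e := by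
          rw [Nat.cast_sub (by omega), Nat.cast_sub hp.one_le]
          simp
        rw [← h4]
        exact_mod_cast h3
      have hi : (((e + 1 : ℕ) : ℚ))⁻¹ * (e + 1) = 1 := by
        push_cast
        field_simp
      rw [harmonic_succ]
      generalize (((e + 1 : ℕ) : ℚ))⁻¹ = i at *
      push_cast
      rw [← hh]
      linear_combination (d : ℚ) * hc + ((p : ℚ) - 1 - e) * ha
        - (-1 : ℚ) ^ e * p * d * hi

theorem choose_p_sub_one_mod_p_sq (p : ℕ) (hp : p.Prime) (ε : ℕ) (hε : ε ≤ p - 1) :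
    RatCong p 2 (((p - 1).choose ε : ℚ)) ((-1 : ℚ) ^ ε * (1 - (p : ℚ) * harmonic ε)) := by
  haveI : Fact p.Prime := ⟨hp⟩
  obtain ⟨a, h, d, hd, -, ha⟩ := choose_aux p hp ε hε
  by_cases hx : ((p - 1).choose ε : ℚ) - (-1 : ℚ) ^ ε * (1 - (p : ℚ) * harmonic ε) = 0
  · exact Or.inl (sub_eq_zero.mp hx)
  · right
    have hd0 : (d : ℚ) ≠ 0 := by
      intro h0
      apply hd
      have : d = 0 := by exact_mod_cast h0
      simp [this]
    have hp0 : (p : ℚ) ≠ 0 := by exact_mod_cast hp.ne_zero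
    have ha0 : (a : ℚ) ≠ 0 := by
      intro h0
      rw [h0, mul_zero] at ha
      exact (mul_ne_zero hx hd0) ha
    have hv := congrArg (padicValRat p) ha
    rw [padicValRat.mul hx hd0, padicValRat.mul (pow_ne_zero 2 hp0) ha0, padicValRat.pow,
      padicValRat.self hp.one_lt, padicValRat.of_int, padicValRat.of_int,
      padicValInt.eq_zero_of_not_dvd hd] at hv
    push_cast at hv ⊢
    omega
end
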